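/- Let (W,S) be a finite Coxeter system and let J, K, L ⊆ S with L ⊆ K (so that W_L ⊆ W_K). Then for every w ∈ D_{JK}, the set W_J w W_K ∩ D_{JL} is nonempty and contains a unique element of maximal length. (This is the combinatorial part of Lemma 5.6 of the paper: for P_μ ⊆ P_ν, the set 𝕎_γ w 𝕎_ν ∩ 𝒟_{γμ} has a unique longest element w′.) -/

import Mathlib

noncomputable section

/-- The standard parabolic subgroup `W_J = ⟨s_i : i ∈ J⟩` of a Coxeter system. -/
def parab {B W : Type*} [Group W] {M : CoxeterMatrix B} (cs : CoxeterSystem M W)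
    (J : Set B) : Subgroup W :=
  Subgroup.closure (cs.simple '' J)

/-- The set `D_J` of minimal-length right coset representatives of `W_J` in `W`. -/
def DJ {B W : Type*} [Group W] {M : CoxeterMatrix B} (cs : CoxeterSystem M W)
    (J : Set B) : Set W :=
  {w | ∀ v ∈ parab cs J, cs.length (v * w) = cs.length v + cs.length w}

/-- The set `D_{JK} = D_J ∩ D_K⁻¹` of minimal-length double coset representatives. -/
def DJK {B W : Type*} [Group W] {M : CoxeterMatrix B} (cs : CoxeterSystem M W)
    (J K : Set B) : Set W :=
  DJ cs J ∩ {w | w⁻¹ ∈ DJ cs K}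

/-- The double coset `W_J w W_K` as a subset of `W`. -/
def dcoset {B W : Type*} [Group W] {M : CoxeterMatrix B} (cs : CoxeterSystem M W)
    (J K : Set B) (w : W) : Set W :=
  {σ | ∃ v ∈ parab cs J, ∃ u ∈ parab cs K, σ = v * w * u}

namespace CoxeterSystem

variable {B W : Type*} [Group W] {M : CoxeterMatrix B} (cs : CoxeterSystem M W)

open Classical in
/-- The involution `(t, e) ↦ (s_i t s_i, e + [t = s_i])` of `W × ℤ/2`. -/
def signedConj (i : B) : Equiv.Perm (W × ZMod 2) :=
  Function.Involutive.toPerm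
    (fun p ↦ (cs.simple i * p.1 * cs.simple i, p.2 + if p.1 = cs.simple i then 1 else 0)) <| by
    rintro ⟨t, e⟩
    have h : cs.simple i * t * cs.simple i = cs.simple i ↔ t = cs.simple i := by
      constructor
      · intro h
        have h' := congrArg (fun x ↦ cs.simple i * x * cs.simple i) h
        simpa [mul_assoc] using h'
      · rintro rfl
        simp
    ext
    · simp [mul_assoc]
    · simp only [h, add_assoc, CharTwo.add_self_eq_zero, add_zero]

open Classical in
theorem signedConj_apply (i : B) (p : W × ZMod 2) :
    cs.signedConj i p =
      (cs.simple i * p.1 * cs.simple i, p.2 + if p.1 = cs.simple i then 1 else 0) := rfl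

open Classical in
theorem signedConj_mul_pow_apply (i j : B) (n : ℕ) (t : W) (e : ZMod 2) :
    ((cs.signedConj i * cs.signedConj j) ^ n) (t, e) =
      ((cs.simple i * cs.simple j) ^ n * t * ((cs.simple i * cs.simple j) ^ n)⁻¹,
        e + ∑ k ∈ Finset.range (2 * n),
          if (cs.simple i * cs.simple j) ^ k * t = cs.simple j then 1 else 0) := by
  induction n with
  | zero => simp
  | succ n ih =>
    have hc : ∀ n : ℕ, cs.simple j * (cs.simple i * cs.simple j) ^ n =
        ((cs.simple i * cs.simple j) ^ n)⁻¹ * cs.simple j := by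
      intro n
      induction n with
      | zero => simp
      | succ n ih =>
        have h1 : cs.simple j * (cs.simple i * cs.simple j) =
            (cs.simple i * cs.simple j)⁻¹ * cs.simple j := by simp [mul_assoc]
        rw [pow_succ, ← mul_assoc, ih, mul_assoc, h1, ← mul_assoc, ← mul_inv_rev, ← pow_succ',
          pow_succ]
    rw [pow_succ', Equiv.Perm.mul_apply, ih, Equiv.Perm.mul_apply, signedConj_apply,
      signedConj_apply, show 2 * (n + 1) = 2 * n + 1 + 1 by ring, Finset.sum_range_succ,
      Finset.sum_range_succ]
    generalize hR : cs.simple i * cs.simple j = r at *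
    have e1 : r ^ n * t * (r ^ n)⁻¹ = cs.simple j ↔ r ^ (2 * n) * t = cs.simple j := by
      rw [mul_inv_eq_iff_eq_mul, hc, eq_inv_mul_iff_mul_eq, ← mul_assoc, ← pow_add, two_mul]
    have e2 : cs.simple j * (r ^ n * t * (r ^ n)⁻¹) * cs.simple j = cs.simple i ↔
        r ^ (2 * n + 1) * t = cs.simple j := by
      have hi : cs.simple i = r * cs.simple j := by simp [← hR]
      have hj : cs.simple j * r = r⁻¹ * cs.simple j := by simpa using hc 1
      rw [hi, ← mul_left_inj (cs.simple j), mul_assoc, mul_assoc r, cs.simple_mul_simple_self,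
        mul_one, mul_one, ← mul_right_inj (cs.simple j), ← mul_assoc, cs.simple_mul_simple_self,
        one_mul, hj, mul_inv_eq_iff_eq_mul, mul_assoc, hc, eq_inv_mul_iff_mul_eq,
        eq_inv_mul_iff_mul_eq, ← mul_assoc, ← mul_assoc, ← pow_succ, ← pow_add]
      ring_nf
    simp only [e1, e2]
    ext
    · simp only [pow_succ', mul_inv_rev, ← hR, mul_assoc, cs.inv_simple]
    · simp only [add_assoc]

theorem isLiftable_signedConj : M.IsLiftable cs.signedConj := by
  classical
  intro i j
  ext1 ⟨t, e⟩
  rw [signedConj_mul_pow_apply, two_mul, Finset.sum_range_add]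
  simp [pow_add, CharTwo.add_self_eq_zero]

/-- The representation of `W` on `W × ℤ/2` extending `signedConj`. -/
def signedConjHom : W →* Equiv.Perm (W × ZMod 2) :=
  cs.lift ⟨cs.signedConj, cs.isLiftable_signedConj⟩

theorem signedConjHom_simple (i : B) : cs.signedConjHom (cs.simple i) = cs.signedConj i :=
  cs.lift_apply_simple cs.isLiftable_signedConj i

/-- The inversion cocycle, equal to `1` at `(w, t)` exactly when `t` is a right inversion of `w`
(for `t` a reflection). -/
def invCocycle (w t : W) : ZMod 2 := (cs.signedConjHom w (t, 0)).2

theorem signedConjHom_apply (w t : W) (e : ZMod 2) :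
    cs.signedConjHom w (t, e) = (w * t * w⁻¹, e + cs.invCocycle w t) := by
  unfold invCocycle
  induction w using cs.simple_induction_left generalizing t e with
  | one => simp
  | mul_simple_left w i ih =>
    rw [map_mul, Equiv.Perm.mul_apply, Equiv.Perm.mul_apply, ih, ih t 0, signedConjHom_simple,
      signedConj_apply, signedConj_apply]
    simp [mul_assoc, add_assoc]

theorem invCocycle_mul (u w t : W) :
    cs.invCocycle (u * w) t = cs.invCocycle w t + cs.invCocycle u (w * t * w⁻¹) := by
  rw [invCocycle, map_mul, Equiv.Perm.mul_apply, signedConjHom_apply, signedConjHom_apply]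
  simp

theorem invCocycle_one (t : W) : cs.invCocycle 1 t = 0 := by simp [invCocycle]

open Classical in
theorem invCocycle_simple (i : B) (t : W) :
    cs.invCocycle (cs.simple i) t = if t = cs.simple i then 1 else 0 := by
  simp [invCocycle, signedConjHom_simple, signedConj_apply]

theorem invCocycle_self {t : W} (ht : cs.IsReflection t) : cs.invCocycle t t = 1 := by
  obtain ⟨u, i, rfl⟩ := ht
  have h := cs.invCocycle_mul u u⁻¹ (u * cs.simple i * u⁻¹)
  rw [mul_inv_cancel, invCocycle_one] at h
  rw [invCocycle_mul, invCocycle_mul]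
  simp only [mul_assoc, inv_mul_cancel_left, inv_inv, inv_mul_cancel, mul_one, one_mul,
    invCocycle_simple, cs.inv_simple, cs.simple_mul_simple_self, if_true] at h ⊢
  linear_combination -h

open Classical in
theorem mem_rightInvSeq_of_invCocycle_ne_zero (ω : List B) (t : W)
    (h : cs.invCocycle (cs.wordProd ω) t ≠ 0) : t ∈ cs.rightInvSeq ω := by
  induction ω with
  | nil => simp [invCocycle_one] at h
  | cons i ω ih =>
    rw [wordProd_cons, invCocycle_mul, invCocycle_simple] at h
    rw [rightInvSeq, List.mem_cons]
    by_cases h' : cs.invCocycle (cs.wordProd ω) t = 0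
    · left
      rw [h', zero_add] at h
      have h2 := (ite_ne_right_iff.mp h).1
      rw [← h2]
      group
    · exact Or.inr (ih h')

theorem length_mul_lt_of_invCocycle_ne_zero (w t : W) (h : cs.invCocycle w t ≠ 0) :
    cs.length (w * t) < cs.length w := by
  obtain ⟨ω, hω, rfl⟩ := cs.exists_isReduced w
  exact (cs.isRightInversion_of_mem_rightInvSeq hω
    (cs.mem_rightInvSeq_of_invCocycle_ne_zero ω t h)).2

theorem invCocycle_ne_zero_iff (w : W) {t : W} (ht : cs.IsReflection t) :
    cs.invCocycle w t ≠ 0 ↔ cs.length (w * t) < cs.length w := by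
  refine ⟨cs.length_mul_lt_of_invCocycle_ne_zero w t, fun h h0 ↦ ?_⟩
  have h1 : cs.invCocycle (w * t) t ≠ 0 := by
    rw [invCocycle_mul, cs.invCocycle_self ht, ht.mul_self, one_mul, ht.inv]
    simp [h0]
  have h2 := cs.length_mul_lt_of_invCocycle_ne_zero _ _ h1
  rw [mul_assoc, ht.mul_self, mul_one] at h2
  omega

/-- Right multiplication by a simple reflection `s_i` preserves the comparison of lengths of
`w` and `w * t`, for a reflection `t ≠ s_i`. -/
theorem length_mul_mul_simple_lt_iff (w : W) {t : W} (ht : cs.IsReflection t) (i : B)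
    (hti : t ≠ cs.simple i) :
    cs.length (w * t * cs.simple i) < cs.length (w * cs.simple i) ↔
      cs.length (w * t) < cs.length w := by
  have h1 := ht.conj (cs.simple i)
  rw [cs.inv_simple] at h1
  have hne : cs.simple i * t * cs.simple i ≠ cs.simple i := by
    intro h
    apply hti
    have h' := congrArg (fun x ↦ cs.simple i * x * cs.simple i) h
    simpa [mul_assoc] using h'
  rw [← cs.invCocycle_ne_zero_iff w ht,
    show w * t * cs.simple i = w * cs.simple i * (cs.simple i * t * cs.simple i) by
      simp [mul_assoc],
    ← cs.invCocycle_ne_zero_iff _ h1, invCocycle_mul, invCocycle_simple, if_neg hne]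
  simp [mul_assoc]

/-- A step `x < x * t`, for a reflection `t`, generating the Bruhat order. -/
def BruhatStep (x y : W) : Prop :=
  ∃ t, cs.IsReflection t ∧ y = x * t ∧ cs.length x < cs.length y

/-- The Bruhat order. -/
def BruhatLE : W → W → Prop := Relation.ReflTransGen cs.BruhatStep

variable {cs} {x y : W}

theorem BruhatLE.inv (h : cs.BruhatLE x y) : cs.BruhatLE x⁻¹ y⁻¹ := by
  refine Relation.ReflTransGen.lift (r := cs.BruhatStep) (fun x ↦ x⁻¹) ?_ _ _ h
  rintro x y ⟨t, ht, rfl, hl⟩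
  refine ⟨x * t * x⁻¹, ht.conj x, ?_, by simpa only [cs.length_inv] using hl⟩
  simp [ht.inv, mul_assoc]

theorem BruhatLE.eq_or_length_lt (h : cs.BruhatLE x y) : x = y ∨ cs.length x < cs.length y := by
  induction h with
  | refl => exact Or.inl rfl
  | tail _ h ih =>
    obtain ⟨t, -, -, hl⟩ := h
    rcases ih with rfl | ih
    · exact Or.inr hl
    · exact Or.inr (ih.trans hl)

theorem BruhatStep.mul_simple (h : cs.BruhatStep x y) (i : B) :
    x * cs.simple i = y ∨ cs.BruhatStep (x * cs.simple i) (y * cs.simple i) := by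
  obtain ⟨t, ht, rfl, hl⟩ := h
  by_cases hti : t = cs.simple i
  · exact Or.inl (by rw [hti])
  · right
    have h1 := ht.conj (cs.simple i)
    rw [cs.inv_simple] at h1
    refine ⟨_, h1, by simp [mul_assoc], ?_⟩
    have h2 := cs.length_mul_mul_simple_lt_iff (x * t) ht i hti
    rw [mul_assoc x t t, ht.mul_self, mul_one] at h2
    exact h2.2 hl

theorem bruhatLE_mul_simple (i : B) (h : cs.length x < cs.length (x * cs.simple i)) :
    cs.BruhatLE x (x * cs.simple i) :=
  .single ⟨_, cs.isReflection_simple i, rfl, h⟩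

/-- The lower set of `y` is stable under right multiplication by right descents of `y`. -/
theorem BruhatLE.mul_simple_left (h : cs.BruhatLE x y) (i : B)
    (hy : cs.length (y * cs.simple i) < cs.length y) : cs.BruhatLE (x * cs.simple i) y := by
  induction h using Relation.ReflTransGen.head_induction_on with
  | refl => simpa using bruhatLE_mul_simple (cs := cs) (x := y * cs.simple i) i (by simpa using hy)
  | head h hzy ih =>
    rcases h.mul_simple i with h | h
    · exact h ▸ hzy
    · exact .head h ih

/-- The upper set of `x` is stable under right multiplication by non-descents of `x`. -/
theorem BruhatLE.mul_simple_right (h : cs.BruhatLE x y) (i : B)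
    (hx : cs.length x < cs.length (x * cs.simple i)) : cs.BruhatLE x (y * cs.simple i) := by
  induction h with
  | refl => exact bruhatLE_mul_simple i hx
  | tail hxz h ih =>
    rcases h.mul_simple i with h | h
    · rw [← h, mul_assoc, cs.simple_mul_simple_self, mul_one]
      exact hxz
    · exact .tail ih h

end CoxeterSystem

section Parabolic

variable {B W : Type*} [Group W] {M : CoxeterMatrix B} {cs : CoxeterSystem M W} {J : Set B}

theorem simple_mem_parab {i : B} (hi : i ∈ J) : cs.simple i ∈ parab cs J :=
  Subgroup.subset_closure ⟨i, hi, rfl⟩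

theorem parab_induction {p : (v : W) → v ∈ parab cs J → Prop} (one : p 1 (one_mem _))
    (mul : ∀ v i hv (hi : i ∈ J), p v hv →
      p (v * cs.simple i) (mul_mem hv (simple_mem_parab hi)))
    {v : W} (hv : v ∈ parab cs J) : p v hv := by
  induction hv using Subgroup.closure_induction_right with
  | one => exact one
  | mul_right v hv s hs ih =>
    obtain ⟨i, hi, rfl⟩ := hs
    exact mul v i hv hi ih
  | mul_inv_cancel v hv s hs ih =>
    obtain ⟨i, hi, rfl⟩ := hs
    simpa only [cs.inv_simple] using mul v i hv hi ih

theorem exists_word_length_mul {n : W}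
    (hn : ∀ v ∈ parab cs J, cs.length n ≤ cs.length (n * v)) {v : W} (hv : v ∈ parab cs J) :
    ∃ ω : List B, cs.wordProd ω = v ∧ cs.length (n * v) = cs.length n + ω.length := by
  induction hv using parab_induction with
  | one => exact ⟨[], by simp⟩
  | mul v i hv hi ih =>
    obtain ⟨ω, rfl, hl⟩ := ih
    rcases cs.length_mul_simple (n * cs.wordProd ω) i with h | h
    · refine ⟨ω.concat i, cs.wordProd_concat i ω, ?_⟩
      rw [← mul_assoc, h, hl, List.length_concat, add_assoc]
    · have h1 := (cs.invCocycle_ne_zero_iff (n * cs.wordProd ω) (cs.isReflection_simple i)).2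
        (by omega)
      have h2 : cs.invCocycle n (cs.wordProd ω * cs.simple i * (cs.wordProd ω)⁻¹) = 0 := by
        by_contra h2
        have h3 := cs.length_mul_lt_of_invCocycle_ne_zero _ _ h2
        have h4 := hn _ (mul_mem (mul_mem hv (simple_mem_parab hi)) (inv_mem hv))
        omega
      rw [cs.invCocycle_mul, h2, add_zero] at h1
      obtain ⟨j, hj, hji⟩ := List.getElem_of_mem (cs.mem_rightInvSeq_of_invCocycle_ne_zero ω _ h1)
      refine ⟨ω.eraseIdx j, ?_, ?_⟩
      · rw [← cs.wordProd_mul_getD_rightInvSeq, List.getD_eq_getElem _ _ hj, hji]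
      · rw [cs.length_rightInvSeq] at hj
        rw [List.length_eraseIdx_of_lt hj, ← mul_assoc]
        omega

theorem inv_mem_DJ_of_minimal {n : W}
    (hn : ∀ v ∈ parab cs J, cs.length n ≤ cs.length (n * v)) : n⁻¹ ∈ DJ cs J := by
  intro v hv
  obtain ⟨ω, hω, hl⟩ := exists_word_length_mul hn (inv_mem hv)
  have h1 := cs.length_wordProd_le ω
  rw [hω, cs.length_inv] at h1
  have h2 : cs.length (v * n⁻¹) = cs.length (n * v⁻¹) := by
    rw [← cs.length_inv, mul_inv_rev, inv_inv]
  have h3 := cs.length_mul_le v n⁻¹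
  rw [cs.length_inv] at h3 ⊢
  omega

theorem mem_DJ_of_minimal {n : W}
    (hn : ∀ v ∈ parab cs J, cs.length n ≤ cs.length (v * n)) : n ∈ DJ cs J := by
  rw [← inv_inv n]
  refine inv_mem_DJ_of_minimal fun v hv ↦ ?_
  rw [cs.length_inv, ← cs.length_inv (n⁻¹ * v), mul_inv_rev, inv_inv]
  exact hn _ (inv_mem hv)

theorem length_lt_length_mul_simple {x : W} (hx : x⁻¹ ∈ DJ cs J) {i : B} (hi : i ∈ J) :
    cs.length x < cs.length (x * cs.simple i) := by
  have h := hx _ (simple_mem_parab hi)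
  rw [← cs.length_inv, mul_inv_rev, inv_inv, cs.inv_simple, cs.length_simple, cs.length_inv] at h
  omega

theorem bruhatLE_mul_right_of_inv_mem_DJ {x y v : W} (h : cs.BruhatLE x y) (hx : x⁻¹ ∈ DJ cs J)
    (hv : v ∈ parab cs J) : cs.BruhatLE x (y * v) := by
  induction hv using parab_induction with
  | one => simpa
  | mul v i hv hi ih =>
    rw [← mul_assoc]
    exact ih.mul_simple_right i (length_lt_length_mul_simple hx hi)

theorem bruhatLE_mul_left_of_mem_DJ {x y v : W} (h : cs.BruhatLE x y) (hx : x ∈ DJ cs J)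
    (hv : v ∈ parab cs J) : cs.BruhatLE x (v * y) := by
  have h1 := bruhatLE_mul_right_of_inv_mem_DJ h.inv (by rwa [inv_inv]) (inv_mem hv)
  simpa using h1.inv

theorem bruhatLE_mul_right_of_maximal {x y v : W} (h : cs.BruhatLE x y)
    (hy : ∀ i ∈ J, cs.length (y * cs.simple i) ≤ cs.length y) (hv : v ∈ parab cs J) :
    cs.BruhatLE (x * v) y := by
  induction hv using parab_induction with
  | one => simpa
  | mul v i hv hi ih =>
    rw [← mul_assoc]
    exact ih.mul_simple_left i (lt_of_le_of_ne (hy i hi) (cs.length_mul_simple_ne y i))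

theorem bruhatLE_mul_left_of_maximal {x y v : W} (h : cs.BruhatLE x y)
    (hy : ∀ i ∈ J, cs.length (cs.simple i * y) ≤ cs.length y) (hv : v ∈ parab cs J) :
    cs.BruhatLE (v * x) y := by
  have h1 := bruhatLE_mul_right_of_maximal h.inv (fun i hi ↦ ?_) (inv_mem hv)
  · simpa using h1.inv
  · rw [← cs.length_inv, mul_inv_rev, inv_inv, cs.inv_simple, cs.length_inv y]
    exact hy i hi

variable {K L : Set B} {w : W}

theorem mul_mem_dcoset {a v u : W} (ha : a ∈ dcoset cs J K w) (hv : v ∈ parab cs J)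
    (hu : u ∈ parab cs K) : v * a * u ∈ dcoset cs J K w := by
  obtain ⟨v', hv', u', hu', rfl⟩ := ha
  exact ⟨v * v', mul_mem hv hv', u' * u, mul_mem hu' hu, by simp only [mul_assoc]⟩

theorem mul_left_mem_dcoset {a v : W} (ha : a ∈ dcoset cs J K w) (hv : v ∈ parab cs J) :
    v * a ∈ dcoset cs J K w := by
  simpa using mul_mem_dcoset ha hv (one_mem _)

theorem mul_right_mem_dcoset {a u : W} (ha : a ∈ dcoset cs J K w) (hu : u ∈ parab cs K) :
    a * u ∈ dcoset cs J K w := by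
  simpa using mul_mem_dcoset ha (one_mem _) hu

theorem exists_bruhatLE_greatest_dcoset [Finite W] (cs : CoxeterSystem M W) (J K : Set B)
    (w : W) : ∃ y ∈ dcoset cs J K w, ∀ x ∈ dcoset cs J K w, cs.BruhatLE x y := by
  have hw : w ∈ dcoset cs J K w := ⟨1, one_mem _, 1, one_mem _, by simp⟩
  obtain ⟨y, hy, hmax⟩ := Set.exists_max_image _ cs.length (Set.toFinite (dcoset cs J K w)) ⟨w, hw⟩
  refine ⟨y, hy, ?_⟩
  have key : ∀ v ∈ parab cs J, ∀ u ∈ parab cs K, cs.BruhatLE (v * y * u) y := fun v hv u hu ↦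
    bruhatLE_mul_right_of_maximal
      (bruhatLE_mul_left_of_maximal .refl
        (fun i hi ↦ hmax _ (mul_left_mem_dcoset hy (simple_mem_parab hi))) hv)
      (fun i hi ↦ hmax _ (mul_right_mem_dcoset hy (simple_mem_parab hi))) hu
  rintro x ⟨v, hv, u, hu, rfl⟩
  obtain ⟨v', hv', u', hu', rfl⟩ := hy
  convert key _ (mul_mem hv (inv_mem hv')) _ (mul_mem (inv_mem hu') hu) using 1
  group

theorem exists_bruhatLE_greatest_dcoset_inter_DJK [Finite W] (cs : CoxeterSystem M W)
    (hLK : L ⊆ K) (w : W) :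
    ∃ m ∈ dcoset cs J K w ∩ DJK cs J L,
      ∀ x ∈ dcoset cs J K w ∩ DJK cs J L, cs.BruhatLE x m := by
  have hsub : parab cs L ≤ parab cs K := Subgroup.closure_mono (Set.image_mono hLK)
  obtain ⟨y, hy, hgreat⟩ := exists_bruhatLE_greatest_dcoset cs J K w
  obtain ⟨m, ⟨hm, hbound⟩, hmin⟩ := Set.exists_min_image
    {m ∈ dcoset cs J K w | ∀ x ∈ dcoset cs J K w ∩ DJK cs J L, cs.BruhatLE x m} cs.length
    (Set.toFinite _) ⟨y, hy, fun x hx ↦ hgreat x hx.1⟩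
  refine ⟨m, ⟨hm, mem_DJ_of_minimal fun v hv ↦ ?_, inv_mem_DJ_of_minimal fun u hu ↦ ?_⟩, hbound⟩
  · exact hmin _ ⟨mul_left_mem_dcoset hm hv,
      fun x hx ↦ bruhatLE_mul_left_of_mem_DJ (hbound x hx) hx.2.1 hv⟩
  · exact hmin _ ⟨mul_right_mem_dcoset hm (hsub hu),
      fun x hx ↦ bruhatLE_mul_right_of_inv_mem_DJ (hbound x hx) hx.2.2 hu⟩

end Parabolic

/-- Let `(W,S)` be a finite Coxeter system and `J, K, L ⊆ S` with
`L ⊆ K` (so `W_L ⊆ W_K`). Then for every `w ∈ D_{JK}`, the set `W_J w W_K ∩ D_{JL}`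
is nonempty and contains a unique element of maximal length. -/
theorem stmt7 {B W : Type*} [Group W] [Finite W] {M : CoxeterMatrix B}
    (cs : CoxeterSystem M W) (J K L : Set B) (hLK : L ⊆ K)
    (w : W) (hw : w ∈ DJK cs J K) :
    (dcoset cs J K w ∩ DJK cs J L).Nonempty ∧
      ∃! m, m ∈ dcoset cs J K w ∩ DJK cs J L ∧
        ∀ σ ∈ dcoset cs J K w ∩ DJK cs J L, cs.length σ ≤ cs.length m := by
  obtain ⟨m, hm, hgreat⟩ := exists_bruhatLE_greatest_dcoset_inter_DJK (J := J) cs hLK w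
  refine ⟨⟨m, hm⟩, m, ⟨hm, fun σ hσ ↦ ?_⟩, fun m' ⟨hm', hmax⟩ ↦ ?_⟩
  · rcases (hgreat σ hσ).eq_or_length_lt with rfl | h
    · exact le_rfl
    · exact h.le
  · exact (hgreat m' hm').eq_or_length_lt.resolve_right (hmax m hm).not_gt
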